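/- The set of points making few returns to S has measure of order 1/n: for every b > 0 there exists C > 0 such that for all n ≥ 2, μ {z ∈ R | r(z, n) ≤ b * Real.log n} ≤ C / n, where r(z, n) = ((Finset.Icc 1 n).filter (fun i => H^[i] z ∈ S)).card is the number of the first n images of z lying in S. -/

import Mathlib

open MeasureTheory
open scoped NNReal ENNReal

noncomputable section

instance : Fact ((0:ℝ) < 2) := ⟨by norm_num⟩

/-- The torus, as a product of two circles of circumference 2. -/
abbrev 𝕋 : Type := AddCircle (2:ℝ) × AddCircle (2:ℝ)

/-- The unique representative in `[0, 2)` of a point of the circle. -/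
def θ (x : AddCircle (2:ℝ)) : ℝ := ((AddCircle.equivIco 2 0) x : ℝ)

def P : Set 𝕋 := {z | θ z.2 ≤ 1}
def Q : Set 𝕋 := {z | θ z.1 ≤ 1}
def R : Set 𝕋 := P ∪ Q
def S : Set 𝕋 := P ∩ Q

/-- The horizontal twist map. -/
def F (z : 𝕋) : 𝕋 :=
  if θ z.2 ≤ 1 then (z.1 + (((2 * θ z.2 : ℝ) : AddCircle (2:ℝ))), z.2) else z

/-- The vertical twist map. -/
def G (z : 𝕋) : 𝕋 :=
  if θ z.1 ≤ 1 then (z.1, z.2 + (((2 * θ z.1 : ℝ) : AddCircle (2:ℝ)))) else z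

/-- The linked-twist map. -/
def H : 𝕋 → 𝕋 := G ∘ F

/-- The first-return time of `T` to `S`. -/
def rtn (T : 𝕋 → 𝕋) (z : 𝕋) : ℕ := sInf {n : ℕ | 1 ≤ n ∧ T^[n] z ∈ S}

/-- The first-return map of `T` to `S`. -/
def retMap (T : 𝕋 → 𝕋) (z : 𝕋) : 𝕋 := T^[rtn T z] z

/-- The set of points of `S` with return time exactly `n`. -/
def Sn (n : ℕ) : Set 𝕋 := {z | z ∈ S ∧ rtn H z = n}

open scoped Classical in
/-- The number of the first `n` images of `z` under `H` lying in `S`. -/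
def r (z : 𝕋) (n : ℕ) : ℕ := ((Finset.Icc 1 n).filter (fun i => H^[i] z ∈ S)).card

lemma theta_nonneg (x : AddCircle (2:ℝ)) : 0 ≤ θ x := ((AddCircle.equivIco 2 0) x).2.1

lemma theta_lt_two (x : AddCircle (2:ℝ)) : θ x < 2 :=
  ((AddCircle.equivIco 2 0) x).2.2.trans_eq (zero_add 2)

lemma coe_theta (x : AddCircle (2:ℝ)) : ((θ x : ℝ) : AddCircle (2:ℝ)) = x :=
  AddCircle.coe_equivIco

lemma theta_coe {t : ℝ} (h0 : 0 ≤ t) (h2 : t < 2) : θ (t : AddCircle (2:ℝ)) = t := by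
  have h : t ∈ Set.Ico (0:ℝ) (0 + 2) := ⟨h0, by linarith⟩
  simp [θ, AddCircle.equivIco_coe_eq h]

/-- Rotating by `t ∈ [0, 2]` adds `t` to the representative, up to one wrap-around. -/
lemma theta_add_coe (x : AddCircle (2:ℝ)) {t : ℝ} (h0 : 0 ≤ t) (h2 : t ≤ 2) :
    (θ (x + (t : AddCircle (2:ℝ))) = θ x + t ∧ θ x + t < 2) ∨
      (θ (x + (t : AddCircle (2:ℝ))) = θ x + t - 2 ∧ 2 ≤ θ x + t) := by
  have hx0 := theta_nonneg x
  have hx2 := theta_lt_two x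
  rcases lt_or_ge (θ x + t) 2 with h | h
  · refine Or.inl ⟨?_, h⟩
    conv_lhs => rw [← coe_theta x, ← AddCircle.coe_add]
    exact theta_coe (by linarith) h
  · refine Or.inr ⟨?_, h⟩
    have hc : x + (t : AddCircle (2:ℝ)) = ((θ x + t - 2 : ℝ) : AddCircle (2:ℝ)) := by
      conv_lhs => rw [← coe_theta x]
      rw [AddCircle.coe_sub, AddCircle.coe_add, AddCircle.coe_period, sub_zero]
    rw [hc]
    exact theta_coe (by linarith) (by linarith)

lemma measurable_theta : Measurable θ := by
  unfold θ
  exact measurable_subtype_coe.comp (AddCircle.measurableEquivIco 2 0).measurable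

lemma measurePreserving_G : MeasurePreserving G := by
  have hm : Measurable fun x : AddCircle (2:ℝ) =>
      if θ x ≤ 1 then ((2 * θ x : ℝ) : AddCircle (2:ℝ)) else 0 :=
    Measurable.ite (measurableSet_le measurable_theta measurable_const)
      (AddCircle.measurable_mk'.comp (measurable_const.mul measurable_theta)) measurable_const
  have h := (MeasurePreserving.id (volume : Measure (AddCircle (2:ℝ)))).skew_product
    (μc := (volume : Measure (AddCircle (2:ℝ)))) (μd := (volume : Measure (AddCircle (2:ℝ))))
    (g := fun x y => y + if θ x ≤ 1 then ((2 * θ x : ℝ) : AddCircle (2:ℝ)) else 0)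
    (measurable_snd.add (hm.comp measurable_fst))
    (Filter.Eventually.of_forall fun x => (measurePreserving_add_right _ _).map_eq)
  rw [Measure.volume_eq_prod]
  convert h using 1
  funext z
  unfold G
  split_ifs <;> simp

lemma F_eq_swap_G_swap : F = Prod.swap ∘ G ∘ Prod.swap := by
  funext z
  by_cases hz : θ z.2 ≤ 1 <;> simp [F, G, hz]

lemma measurePreserving_H : MeasurePreserving H := by
  have hs : MeasurePreserving (Prod.swap : 𝕋 → 𝕋) := Measure.measurePreserving_swap
  unfold H
  rw [F_eq_swap_G_swap]
  exact measurePreserving_G.comp (hs.comp (measurePreserving_G.comp hs))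

lemma G_fst (z : 𝕋) : (G z).1 = z.1 := by
  unfold G; split_ifs <;> rfl

lemma F_snd (z : 𝕋) : (F z).2 = z.2 := by
  unfold F; split_ifs <;> rfl

lemma H_fst (z : 𝕋) : (H z).1 = (F z).1 := G_fst _

lemma theta_H_fst {z : 𝕋} (hz : z ∈ P) :
    (θ (H z).1 = θ z.1 + 2 * θ z.2 ∧ θ z.1 + 2 * θ z.2 < 2) ∨
      (θ (H z).1 = θ z.1 + 2 * θ z.2 - 2 ∧ 2 ≤ θ z.1 + 2 * θ z.2) := by
  have hz' : θ z.2 ≤ 1 := hz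
  rw [H_fst, F, if_pos hz']
  exact theta_add_coe _ (by linarith [theta_nonneg z.2]) (by linarith)

lemma H_fst_of_notMem_P {z : 𝕋} (hz : z ∉ P) : (H z).1 = z.1 := by
  have hz' : ¬ θ z.2 ≤ 1 := hz
  rw [H_fst, F, if_neg hz']

lemma theta_H_snd {z : 𝕋} (hz : H z ∈ Q) :
    (θ (H z).2 = θ z.2 + 2 * θ (H z).1 ∧ θ z.2 + 2 * θ (H z).1 < 2) ∨
      (θ (H z).2 = θ z.2 + 2 * θ (H z).1 - 2 ∧ 2 ≤ θ z.2 + 2 * θ (H z).1) := by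
  have hz' : θ (F z).1 ≤ 1 := by rw [← H_fst]; exact hz
  have h2 : (H z).2 = z.2 + ((2 * θ (F z).1 : ℝ) : AddCircle (2:ℝ)) := by
    rw [← F_snd z, H, Function.comp_apply, G, if_pos hz']
  rw [h2, H_fst]
  exact theta_add_coe _ (by linarith [theta_nonneg (F z).1]) (by linarith)

lemma H_snd_of_notMem_Q {z : 𝕋} (hz : H z ∉ Q) : (H z).2 = z.2 := by
  have hz' : ¬ θ (F z).1 ≤ 1 := by rw [← H_fst]; exact hz
  rw [H, Function.comp_apply, G, if_neg hz', F_snd]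

lemma H_mem_Q {z : 𝕋} (hz : z ∉ P) (hR : z ∈ R) : H z ∈ Q := by
  have hQ : z ∈ Q := hR.resolve_left hz
  change θ (H z).1 ≤ 1
  rw [H_fst_of_notMem_P hz]
  exact hQ

lemma H_mem_R {z : 𝕋} (hR : z ∈ R) : H z ∈ R := by
  by_cases hQ : H z ∈ Q
  · exact Or.inr hQ
  · have hP : z ∈ P := by_contra fun h => hQ (H_mem_Q h hR)
    left
    change θ (H z).2 ≤ 1
    rw [H_snd_of_notMem_Q hQ]
    exact hP

lemma iterate_H_mem_R {z : 𝕋} (hR : z ∈ R) (i : ℕ) : H^[i] z ∈ R := by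
  induction i with
  | zero => exact hR
  | succ i ih => rw [Function.iterate_succ_apply']; exact H_mem_R ih

/-- `v` lies in `[0, 1]`, within `ε` of one of the endpoints (for `v` in `[0, 2)`). -/
def NearEnd (ε v : ℝ) : Prop := v ≤ ε ∨ (1 - ε ≤ v ∧ v ≤ 1)

/-- `z` lies in `S`, within `ε` of one of the corners `(0, 0)` and `(1, 1)`. -/
def NearCorner (ε : ℝ) (z : 𝕋) : Prop :=
  (θ z.1 ≤ ε ∧ θ z.2 ≤ ε) ∨
    ((1 - ε ≤ θ z.1 ∧ θ z.1 ≤ 1) ∧ (1 - ε ≤ θ z.2 ∧ θ z.2 ≤ 1))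

lemma NearCorner.mono {ε δ : ℝ} {z : 𝕋} (h : NearCorner ε z) (hδ : ε ≤ δ) :
    NearCorner δ z := by
  rcases h with ⟨h1, h2⟩ | ⟨⟨h1, h2⟩, h3, h4⟩
  · exact Or.inl ⟨by linarith, by linarith⟩
  · exact Or.inr ⟨⟨by linarith, by linarith⟩, by linarith, by linarith⟩

lemma NearCorner.mem_S {ε : ℝ} {z : 𝕋} (h : NearCorner ε z) (hε : ε ≤ 1) : z ∈ S := by
  rcases h with ⟨h1, h2⟩ | ⟨⟨h1, h2⟩, h3, h4⟩
  · exact ⟨h2.trans hε, h1.trans hε⟩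
  · exact ⟨h4, h2⟩

lemma NearCorner.map_H {ε : ℝ} {z : 𝕋} (h : NearCorner ε z) (hε : 7 * ε ≤ 1) :
    NearCorner (7 * ε) (H z) := by
  have hu := theta_nonneg z.1
  have hv := theta_nonneg z.2
  have hu' := theta_nonneg (H z).1
  have hv' := theta_nonneg (H z).2
  have hS := h.mem_S (by rcases h with h | h <;> linarith [h.1])
  have hP : z ∈ P := hS.1
  have h1 := theta_H_fst hP
  have hQ : H z ∈ Q := by
    change θ (H z).1 ≤ 1
    rcases h with ⟨ha, hb⟩ | ⟨⟨ha, hb⟩, hc, hd⟩ <;> rcases h1 with h1 | h1 <;> linarith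
  have h2 := theta_H_snd hQ
  rcases h with ⟨ha, hb⟩ | ⟨⟨ha, hb⟩, hc, hd⟩
  · left
    rcases h1 with h1 | h1 <;> rcases h2 with h2 | h2 <;> constructor <;> linarith
  · right
    rcases h1 with h1 | h1 <;> rcases h2 with h2 | h2 <;>
      refine ⟨⟨?_, ?_⟩, ?_, ?_⟩ <;> linarith

lemma NearCorner.iterate_mem_S {q : ℕ} {ε : ℝ} {z : 𝕋} (h : NearCorner ε z) (h0 : 0 ≤ ε)
    (hq : 7 ^ q * ε ≤ 1) {i : ℕ} (hi : i ≤ q) : H^[i] z ∈ S := by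
  have key : ∀ j ≤ q, NearCorner (7 ^ j * ε) (H^[j] z) := by
    intro j
    induction j with
    | zero => intro _; simpa using h
    | succ j ih =>
      intro hj
      rw [Function.iterate_succ_apply', pow_succ', mul_assoc]
      refine (ih (by omega)).map_H (le_trans ?_ hq)
      rw [← mul_assoc, ← pow_succ']
      exact mul_le_mul_of_nonneg_right (pow_le_pow_right₀ (by norm_num) hj) h0
  refine (key i hi).mem_S (le_trans ?_ hq)
  exact mul_le_mul_of_nonneg_right (pow_le_pow_right₀ (by norm_num) hi) h0

lemma nearCorner_of_exit_P {ε : ℝ} {z : 𝕋} (hP : z ∈ P) (hQ : z ∉ Q) (hH : H z ∈ Q)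
    (hε : 10 * ε ≤ 1) (h : NearEnd ε (θ z.2)) : NearCorner (5 * ε) (H z) := by
  have hu := theta_lt_two z.1
  have hv := theta_nonneg z.2
  have hQ' : 1 < θ z.1 := not_le.mp hQ
  have hH' : θ (H z).1 ≤ 1 := hH
  have hu' := theta_nonneg (H z).1
  have h1 := theta_H_fst hP
  have h2 := theta_H_snd hH
  rcases h with ha | ⟨ha, hb⟩
  · left
    rcases h1 with h1 | h1 <;> rcases h2 with h2 | h2 <;> constructor <;> linarith
  · right
    rcases h1 with h1 | h1 <;> rcases h2 with h2 | h2 <;>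
      refine ⟨⟨?_, ?_⟩, ?_, ?_⟩ <;> linarith

lemma nearCorner_of_exit_Q {ε : ℝ} {z : 𝕋} (hR : z ∈ R) (hP : z ∉ P) (hH : H z ∈ S)
    (hε : 2 * ε < 1) (h : NearEnd ε (θ z.1)) : NearCorner (5 * ε) (H z) := by
  have hv := theta_lt_two z.2
  have hu := theta_nonneg z.1
  have hP' : 1 < θ z.2 := not_le.mp hP
  have hH' : θ (H z).2 ≤ 1 := hH.1
  have h1 := H_fst_of_notMem_P hP
  have h2 := theta_H_snd hH.2
  rw [NearCorner]
  rw [h1] at h2 ⊢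
  have hQ : θ z.1 ≤ 1 := hR.resolve_left hP
  rcases h with ha | ⟨ha, hb⟩
  · left
    rcases h2 with h2 | h2 <;> constructor <;> linarith
  · right
    rcases h2 with h2 | h2 <;> refine ⟨⟨?_, ?_⟩, ?_, ?_⟩ <;> linarith

/-- A rotation by `2 * v` whose orbit stays in `(1, 2)` for a long time is close to the identity. -/
lemma nearEnd_of_rotation {s : ℕ → ℝ} {v : ℝ} {a : ℕ} (ha : 0 < a) (hv1 : v ≤ 1)
    (h1 : ∀ i ≤ a, 1 < s i) (h2 : ∀ i ≤ a, s i < 2)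
    (hs : ∀ i < a, s (i + 1) = s i + 2 * v ∨ s (i + 1) = s i + 2 * v - 2) :
    NearEnd (1 / (2 * a)) v := by
  have ha' : (0:ℝ) < 2 * a := by positivity
  rcases le_or_gt v (1 / 2) with hv | hv
  · left
    have key : ∀ i ≤ a, s i = s 0 + 2 * v * i := by
      intro i
      induction i with
      | zero => simp
      | succ i ih =>
        intro hi
        have := ih (by omega)
        have := h1 (i + 1) hi
        have := h2 i (by omega)
        push_cast
        rcases hs i (by omega) with h | h <;> linarith
    rw [le_div_iff₀ ha']
    linarith [key a le_rfl, h1 0 (by omega), h2 a le_rfl]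
  · right
    have key : ∀ i ≤ a, s i = s 0 - 2 * (1 - v) * i := by
      intro i
      induction i with
      | zero => simp
      | succ i ih =>
        intro hi
        have := ih (by omega)
        have := h1 i (by omega)
        have := h2 (i + 1) hi
        push_cast
        rcases hs i (by omega) with h | h <;> linarith
    refine ⟨?_, hv1⟩
    have : 1 - v ≤ 1 / (2 * a) := by
      rw [le_div_iff₀ ha']
      linarith [key a le_rfl, h2 0 (by omega), h1 a le_rfl]
    linarith

/-- An orbit segment avoiding `Q` moves along a horizontal circle. -/
lemma iterate_snd_of_notMem_Q {z : 𝕋} {a : ℕ} (h : ∀ i ≤ a, H^[i] z ∉ Q) :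
    ∀ i ≤ a, (H^[i] z).2 = z.2 := by
  intro i
  induction i with
  | zero => intro _; rfl
  | succ i ih =>
    intro hi
    have h' := h (i + 1) hi
    rw [Function.iterate_succ_apply'] at h' ⊢
    rw [H_snd_of_notMem_Q h', ih (by omega)]

/-- An orbit segment avoiding `P` moves along a vertical circle. -/
lemma iterate_fst_of_notMem_P {z : 𝕋} {a : ℕ} (h : ∀ i ≤ a, H^[i] z ∉ P) :
    ∀ i ≤ a, (H^[i] z).1 = z.1 := by
  intro i
  induction i with
  | zero => intro _; rfl
  | succ i ih =>
    intro hi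
    rw [Function.iterate_succ_apply', H_fst_of_notMem_P (h i (by omega)), ih (by omega)]

lemma nearEnd_of_notMem_Q {z : 𝕋} {a : ℕ} (hR : z ∈ R) (ha : 0 < a)
    (h : ∀ i ≤ a, H^[i] z ∉ Q) : NearEnd (1 / (2 * a)) (θ z.2) := by
  have hP : ∀ i, i ≤ a → H^[i] z ∈ P := fun i hi =>
    (iterate_H_mem_R hR i).resolve_right (h i hi)
  refine nearEnd_of_rotation (s := fun i => θ (H^[i] z).1) ha
    (hP 0 (by omega)) (fun i hi => not_le.mp (h i hi)) (fun i _ => theta_lt_two _) ?_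
  intro i hi
  have h1 := theta_H_fst (hP i hi.le)
  rw [iterate_snd_of_notMem_Q h i hi.le] at h1
  simp only [Function.iterate_succ_apply']
  exact h1.imp And.left And.left

lemma nearEnd_of_notMem_P {z : 𝕋} {a : ℕ} (hR : z ∈ R) (ha : 0 < a)
    (h : ∀ i ≤ a, H^[i] z ∉ P) : NearEnd (1 / (2 * a)) (θ z.1) := by
  have hQ : ∀ i, i ≤ a → H^[i] z ∈ Q := fun i hi =>
    (iterate_H_mem_R hR i).resolve_left (h i hi)
  refine nearEnd_of_rotation (s := fun i => θ (H^[i] z).2) ha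
    (hQ 0 (by omega)) (fun i hi => not_le.mp (h i hi)) (fun i _ => theta_lt_two _) ?_
  intro i hi
  have hQ' := hQ (i + 1) hi
  have hf := iterate_fst_of_notMem_P h (i + 1) hi
  simp only [Function.iterate_succ_apply'] at hQ' hf ⊢
  have h1 := theta_H_snd hQ'
  rw [hf] at h1
  exact h1.imp And.left And.left

/-- A long orbit segment avoiding `S` lies in `P \ Q` throughout or in `Q \ P` after a bounded
time. -/
lemma notMem_Q_or_notMem_P {z : 𝕋} {g : ℕ} (hR : z ∈ R) (hg : 10 < g)
    (hS : ∀ i < g, H^[i] z ∉ S) :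
    (∀ i < g, H^[i] z ∉ Q) ∨ (∀ i, 10 ≤ i → i < g → H^[i] z ∉ P) := by
  have step : ∀ i < g, H^[i] z ∈ Q → H^[i + 1] z ∈ Q := by
    intro i hi hQ
    rw [Function.iterate_succ_apply']
    exact H_mem_Q (fun hP => hS i hi ⟨hP, hQ⟩) (iterate_H_mem_R hR i)
  have up : ∀ i, H^[i] z ∈ Q → ∀ k, i + k ≤ g → H^[i + k] z ∈ Q := by
    intro i hQ k
    induction k with
    | zero => intro _; exact hQ
    | succ k ih => intro hk; exact step (i + k) (by omega) (ih (by omega))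
  by_cases h10 : H^[10] z ∈ Q
  · right
    intro i hi hig hP
    have := up 10 h10 (i - 10) (by omega)
    rw [Nat.add_sub_cancel' hi] at this
    exact hS i hig ⟨hP, this⟩
  · left
    have low : ∀ i ≤ 10, H^[i] z ∉ Q := by
      intro i hi hQ
      have := up i hQ (10 - i) (by omega)
      rw [Nat.add_sub_cancel' hi] at this
      exact h10 this
    have hnear := nearEnd_of_notMem_Q hR (by norm_num) low
    intro i
    induction i using Nat.strong_induction_on with
    | _ i ih =>
      intro hi hQ
      rcases Nat.eq_zero_or_pos i with rfl | hpos
      · exact low 0 (by norm_num) hQ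
      obtain ⟨k, rfl⟩ : ∃ k, i = k + 1 := ⟨i - 1, by omega⟩
      have hk : ∀ j ≤ k, H^[j] z ∉ Q := fun j hj => ih j (by omega) (by omega)
      have hsnd := iterate_snd_of_notMem_Q hk k le_rfl
      rw [← hsnd] at hnear
      apply hS (k + 1) hi
      rw [Function.iterate_succ_apply'] at hQ ⊢
      exact (nearCorner_of_exit_P ((iterate_H_mem_R hR k).resolve_right (hk k le_rfl))
        (hk k le_rfl) hQ (by norm_num) hnear).mem_S (by norm_num)

/-- A first visit to `S` after a long absence takes place near a corner. -/
lemma nearCorner_of_first_visit {z : 𝕋} {g : ℕ} (hR : z ∈ R) (hg : 22 ≤ g)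
    (hS : ∀ i < g, H^[i] z ∉ S) (hgS : H^[g] z ∈ S) :
    NearCorner (5 * (1 / (2 * (g - 11 : ℕ)))) (H^[g] z) := by
  obtain ⟨k, rfl⟩ : ∃ k, g = k + 11 := ⟨g - 11, by omega⟩
  have hk : (11:ℝ) ≤ k := by exact_mod_cast (show 11 ≤ k by omega)
  simp only [Nat.add_sub_cancel]
  have hε : 10 * (1 / (2 * (k:ℝ))) ≤ 1 := by
    rw [mul_one_div, div_le_one (by linarith)]; linarith
  have hRk := iterate_H_mem_R hR (k + 10)
  have hlast : H^[k + 11] z = H (H^[k + 10] z) := Function.iterate_succ_apply' _ _ _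
  rw [hlast] at hgS ⊢
  rcases notMem_Q_or_notMem_P hR (by omega) hS with h | h
  · have hn := nearEnd_of_notMem_Q (a := k + 10) hR (by omega) (fun i hi => h i (by omega))
    rw [← iterate_snd_of_notMem_Q (fun i hi => h i (by omega)) (k + 10) le_rfl] at hn
    have hle : 1 / (2 * ((k + 10 : ℕ) : ℝ)) ≤ 1 / (2 * (k:ℝ)) := by
      push_cast
      apply one_div_le_one_div_of_le <;> linarith
    refine (nearCorner_of_exit_P (hRk.resolve_right (h _ (by omega))) (h _ (by omega)) hgS.2
      (by linarith) hn).mono (by linarith)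
  · have hit : ∀ i ≤ k, H^[i] (H^[10] z) ∉ P := by
      intro i hi
      rw [← Function.iterate_add_apply]
      exact h _ (by omega) (by omega)
    have hn := nearEnd_of_notMem_P (iterate_H_mem_R hR 10) (by omega) hit
    rw [← iterate_fst_of_notMem_P hit k le_rfl, ← Function.iterate_add_apply] at hn
    exact nearCorner_of_exit_Q hRk (h _ (by omega) (by omega)) hgS (by linarith) hn

lemma r_succ_of_mem {z : 𝕋} {n : ℕ} (h : H^[n + 1] z ∈ S) : r z (n + 1) = r z n + 1 := by
  classical
  simp only [r, Finset.card_filter]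
  rw [Finset.sum_Icc_succ_top (by omega), if_pos h]

lemma r_succ_of_notMem {z : 𝕋} {n : ℕ} (h : H^[n + 1] z ∉ S) : r z (n + 1) = r z n := by
  classical
  simp only [r, Finset.card_filter]
  rw [Finset.sum_Icc_succ_top (by omega), if_neg h, add_zero]

lemma r_zero (z : 𝕋) : r z 0 = 0 := by simp [r]

lemma r_add (z : 𝕋) (m k : ℕ) : r z (m + k) = r z m + r (H^[m] z) k := by
  induction k with
  | zero => simp [r_zero]
  | succ k ih =>
    have hit : H^[k + 1] (H^[m] z) = H^[m + k + 1] z := by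
      rw [← Function.iterate_add_apply, show k + 1 + m = m + k + 1 by omega]
    rw [← add_assoc]
    by_cases h : H^[m + k + 1] z ∈ S
    · rw [r_succ_of_mem h, r_succ_of_mem (by rwa [hit]), ih, add_assoc]
    · rw [r_succ_of_notMem h, r_succ_of_notMem (by rwa [hit]), ih]

lemma r_mono (z : 𝕋) {m n : ℕ} (h : m ≤ n) : r z m ≤ r z n := by
  obtain ⟨k, rfl⟩ := Nat.exists_eq_add_of_le h
  rw [r_add]
  exact Nat.le_add_right _ _

lemma r_iterate_le (z : 𝕋) (m k : ℕ) : r (H^[m] z) k ≤ r z (m + k) := by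
  rw [r_add]
  exact Nat.le_add_left _ _

lemma r_eq_zero_iff {z : 𝕋} {n : ℕ} : r z n = 0 ↔ ∀ i < n, H^[i] (H z) ∉ S := by
  classical
  simp only [r, Finset.card_eq_zero, Finset.filter_eq_empty_iff, Finset.mem_Icc,
    ← Function.iterate_succ_apply]
  constructor
  · intro h i hi
    exact h ⟨by omega, by omega⟩
  · rintro h i ⟨h1, h2⟩
    have := h (i - 1) (by omega)
    rwa [Nat.succ_eq_add_one, Nat.sub_add_cancel h1] at this

lemma r_eq_self {z : 𝕋} {n : ℕ} (h : ∀ i < n, H^[i] (H z) ∈ S) : r z n = n := by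
  induction n with
  | zero => exact r_zero z
  | succ n ih =>
    rw [r_succ_of_mem (by rw [Function.iterate_succ_apply]; exact h n (by omega)),
      ih fun i hi => h i (by omega)]

lemma mul_le_r_of_blocks {z : 𝕋} {c L : ℕ} (K : ℕ)
    (h : ∀ j < K, c ≤ r (H^[j * L] z) L) : K * c ≤ r z (K * L) := by
  induction K with
  | zero => simp
  | succ K ih =>
    rw [Nat.succ_mul, Nat.succ_mul, r_add]
    exact add_le_add (ih fun j hj => h j (by omega)) (h K (by omega))

/-- After a long absence from `S`, the first visit is followed by many consecutive visits. -/
lemma le_r_of_absence {z : 𝕋} {q n : ℕ} (hR : z ∈ R) (h0 : r z (14 * 7 ^ q) = 0)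
    (hn : r z n ≠ 0) : q + 1 ≤ r z (n + q) := by
  classical
  rw [r_eq_zero_iff] at h0
  have hex : ∃ t, H^[t] (H z) ∈ S ∧ t < n := by
    rw [Ne, r_eq_zero_iff] at hn
    push Not at hn
    obtain ⟨t, ht, hS⟩ := hn
    exact ⟨t, hS, ht⟩
  have hex' : ∃ t, H^[t] (H z) ∈ S := hex.imp fun _ => And.left
  set g := Nat.find hex' with hg
  have hgS : H^[g] (H z) ∈ S := Nat.find_spec hex'
  have hgn : g < n := by
    obtain ⟨t, ht, htn⟩ := hex
    exact (Nat.find_min' hex' ht).trans_lt htn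
  have hbefore : ∀ i < g, H^[i] (H z) ∉ S := fun i hi => Nat.find_min hex' hi
  have hlong : 14 * 7 ^ q ≤ g := by
    by_contra hlt
    exact h0 g (by omega) hgS
  have hpos : 1 ≤ 7 ^ q := Nat.one_le_pow _ _ (by norm_num)
  rcases Nat.lt_or_ge g 22 with hg22 | hg22
  · have hq : q = 0 := by
      by_contra hq
      have : 7 ^ 1 ≤ 7 ^ q := Nat.pow_le_pow_right (by norm_num) (by omega)
      omega
    subst hq
    have := r_succ_of_mem (z := z) (n := g) (by rw [Function.iterate_succ_apply]; exact hgS)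
    have := r_mono z (show g + 1 ≤ n + 0 by omega)
    omega
  have hc := nearCorner_of_first_visit (H_mem_R hR) hg22 hbefore hgS
  have hsmall : (7:ℝ) ^ q * (5 * (1 / (2 * (g - 11 : ℕ)))) ≤ 1 := by
    have h3 : (3:ℝ) * 7 ^ q ≤ (g - 11 : ℕ) := by
      exact_mod_cast (show 3 * 7 ^ q ≤ g - 11 by omega)
    have h7 : (0:ℝ) < 7 ^ q := by positivity
    rw [mul_one_div, ← mul_div_assoc, div_le_one (by linarith)]
    linarith
  have hrun : r (H^[g] z) (q + 1) = q + 1 := by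
    apply r_eq_self
    intro i hi
    rw [← Function.iterate_succ_apply' H g z, Function.iterate_succ_apply]
    exact hc.iterate_mem_S (by positivity) hsmall (by omega)
  calc q + 1 = r (H^[g] z) (q + 1) := hrun.symm
    _ ≤ r z (g + (q + 1)) := r_iterate_le _ _ _
    _ ≤ r z (n + q) := r_mono _ (by omega)

/-- A visit in the middle third of a long time interval forces many visits in the interval. -/
lemma le_r_of_middle_visit {z : 𝕋} {q h : ℕ} (hR : z ∈ R) (hh : (q + 1) * (14 * 7 ^ q) ≤ h)
    (hm : r (H^[h] z) h ≠ 0) : q + 1 ≤ r z (3 * h) := by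
  have hpos : 1 ≤ 7 ^ q := Nat.one_le_pow _ _ (by norm_num)
  have hqh : q + 1 ≤ h := le_trans (Nat.le_mul_of_pos_right _ (by omega)) hh
  by_cases hb : ∀ j < q + 1, 1 ≤ r (H^[j * (14 * 7 ^ q)] z) (14 * 7 ^ q)
  · have := mul_le_r_of_blocks (q + 1) hb
    have := r_mono z (show (q + 1) * (14 * 7 ^ q) ≤ 3 * h by omega)
    omega
  · push Not at hb
    obtain ⟨j, hj, hj0⟩ := hb
    set s := j * (14 * 7 ^ q) with hs
    have hsh : s ≤ h := le_trans (Nat.mul_le_mul_right _ (by omega)) hh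
    have hvisit : r (H^[s] z) (2 * h - s) ≠ 0 := by
      have e : H^[h] z = H^[h - s] (H^[s] z) := by
        rw [← Function.iterate_add_apply, Nat.sub_add_cancel hsh]
      have := r_iterate_le (H^[s] z) (h - s) h
      rw [← e] at this
      rw [show 2 * h - s = h - s + h by omega]
      omega
    have := le_r_of_absence (q := q) (iterate_H_mem_R hR s) (by omega) hvisit
    have := r_iterate_le z s (2 * h - s + q)
    have := r_mono z (show s + (2 * h - s + q) ≤ 3 * h by omega)
    omega

/-- The points of the circle within `ε` of `0` or `1`. -/
def endBalls (ε : ℝ) : Set (AddCircle (2:ℝ)) :=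
  Metric.closedBall 0 ε ∪ Metric.closedBall ((1:ℝ) : AddCircle (2:ℝ)) ε

lemma measurableSet_endBalls (ε : ℝ) : MeasurableSet (endBalls ε) :=
  Metric.isClosed_closedBall.measurableSet.union Metric.isClosed_closedBall.measurableSet

lemma volume_endBalls_le {ε : ℝ} (hε : 0 ≤ ε) : volume (endBalls ε) ≤ ENNReal.ofReal (4 * ε) := by
  have hball : ∀ x : AddCircle (2:ℝ), volume (Metric.closedBall x ε) ≤ ENNReal.ofReal (2 * ε) := by
    intro x
    rw [AddCircle.volume_closedBall]
    exact ENNReal.ofReal_le_ofReal (min_le_right _ _)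
  calc volume (endBalls ε) ≤ _ := measure_union_le _ _
    _ ≤ ENNReal.ofReal (2 * ε) + ENNReal.ofReal (2 * ε) := add_le_add (hball _) (hball _)
    _ = ENNReal.ofReal (4 * ε) := by
      rw [← ENNReal.ofReal_add (by linarith) (by linarith)]; ring_nf

lemma norm_coe_le_abs (t : ℝ) : ‖(t : AddCircle (2:ℝ))‖ ≤ |t| :=
  QuotientAddGroup.norm_mk_le_norm

lemma mem_endBalls_of_nearEnd {ε : ℝ} {x : AddCircle (2:ℝ)} (h : NearEnd ε (θ x)) :
    x ∈ endBalls ε := by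
  rcases h with h | ⟨h1, h2⟩
  · left
    rw [mem_closedBall_zero_iff, ← coe_theta x]
    refine (norm_coe_le_abs _).trans ?_
    rwa [abs_of_nonneg (theta_nonneg x)]
  · right
    rw [mem_closedBall_iff_norm, ← coe_theta x, ← AddCircle.coe_sub]
    refine (norm_coe_le_abs _).trans ?_
    rw [abs_le]
    constructor <;> linarith

/-- The set of points of `R` avoiding `S` for time `h` has measure of order `1 / h`. -/
lemma volume_absence_le {h : ℕ} (hh : 22 ≤ h) :
    (volume : Measure 𝕋) {z | z ∈ R ∧ r z h = 0} ≤ ENNReal.ofReal (16 / h) := by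
  obtain ⟨k, rfl⟩ : ∃ k, h = k + 11 := ⟨h - 11, by omega⟩
  have hk : (11:ℝ) ≤ k := by exact_mod_cast (show 11 ≤ k by omega)
  set ε : ℝ := 1 / (2 * k) with hε
  have hε0 : 0 ≤ ε := by positivity
  have hsub : {z : 𝕋 | z ∈ R ∧ r z (k + 11) = 0} ⊆
      H ⁻¹' (Set.univ ×ˢ endBalls ε) ∪ H^[11] ⁻¹' (endBalls ε ×ˢ Set.univ) := by
    rintro z ⟨hR, h0⟩
    rw [r_eq_zero_iff] at h0
    have hHR := H_mem_R hR
    rcases notMem_Q_or_notMem_P hHR (by omega) h0 with hc | hc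
    · left
      exact ⟨trivial, mem_endBalls_of_nearEnd
        (nearEnd_of_notMem_Q hHR (by omega) fun i hi => hc i (by omega))⟩
    · right
      refine ⟨mem_endBalls_of_nearEnd (nearEnd_of_notMem_P (iterate_H_mem_R hR 11) (by omega)
        fun i hi => ?_), trivial⟩
      rw [Function.iterate_succ_apply, ← Function.iterate_add_apply]
      exact hc _ (by omega) (by omega)
  have hvol : (volume : Set (AddCircle (2:ℝ)) → ℝ≥0∞) Set.univ = ENNReal.ofReal 2 :=
    AddCircle.measure_univ 2
  have h1 : (volume : Measure 𝕋) (H ⁻¹' (Set.univ ×ˢ endBalls ε)) ≤ ENNReal.ofReal (8 * ε) := by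
    rw [measurePreserving_H.measure_preimage
      (MeasurableSet.univ.prod (measurableSet_endBalls ε)).nullMeasurableSet,
      Measure.volume_eq_prod, Measure.prod_prod, hvol]
    refine (mul_le_mul_right (volume_endBalls_le hε0) _).trans_eq ?_
    rw [← ENNReal.ofReal_mul (by norm_num)]; ring_nf
  have h2 : (volume : Measure 𝕋) (H^[11] ⁻¹' (endBalls ε ×ˢ Set.univ)) ≤
      ENNReal.ofReal (8 * ε) := by
    rw [(measurePreserving_H.iterate 11).measure_preimage
      ((measurableSet_endBalls ε).prod MeasurableSet.univ).nullMeasurableSet,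
      Measure.volume_eq_prod, Measure.prod_prod, hvol]
    refine (mul_le_mul_left (volume_endBalls_le hε0) _).trans_eq ?_
    rw [← ENNReal.ofReal_mul (by linarith)]; ring_nf
  calc _ ≤ _ := measure_mono hsub
    _ ≤ _ := measure_union_le _ _
    _ ≤ ENNReal.ofReal (8 * ε) + ENNReal.ofReal (8 * ε) := add_le_add h1 h2
    _ = ENNReal.ofReal (16 * ε) := by
      rw [← ENNReal.ofReal_add (by linarith) (by linarith)]; ring_nf
    _ ≤ ENNReal.ofReal (16 / (k + 11 : ℕ)) := by
      apply ENNReal.ofReal_le_ofReal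
      rw [hε, mul_one_div]
      push_cast
      exact div_le_div_of_nonneg_left (by norm_num) (by linarith) (by linarith)

/-- A point with few visits to `S` misses `S` during one of boundedly many long time blocks. -/
lemma exists_absence {z : 𝕋} {K q h n : ℕ} (hR : z ∈ R) (hh : (q + 1) * (14 * 7 ^ q) ≤ h)
    (hn : K * (3 * h) ≤ n) (hr : r z n < K * (q + 1)) :
    ∃ j < K, r (H^[h + j * (3 * h)] z) h = 0 := by
  by_contra! hno
  have hblocks := mul_le_r_of_blocks (z := z) (c := q + 1) (L := 3 * h) K fun j hj =>
    le_r_of_middle_visit (iterate_H_mem_R hR _) hh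
      (by rw [← Function.iterate_add_apply]; exact hno j hj)
  have := r_mono z hn
  omega

lemma volume_exists_absence_le {h : ℕ} (hh : 22 ≤ h) (K : ℕ) (t : ℕ → ℕ) :
    (volume : Measure 𝕋) {z | z ∈ R ∧ ∃ j < K, r (H^[t j] z) h = 0} ≤
      ENNReal.ofReal (K * (16 / h)) := by
  set A : Set 𝕋 := toMeasurable volume {z | z ∈ R ∧ r z h = 0}
  have hsub : {z : 𝕋 | z ∈ R ∧ ∃ j < K, r (H^[t j] z) h = 0} ⊆
      ⋃ j ∈ Finset.range K, H^[t j] ⁻¹' A := by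
    rintro z ⟨hR, j, hj, h0⟩
    simp only [Set.mem_iUnion, Finset.mem_range]
    exact ⟨j, hj, subset_toMeasurable _ _ ⟨iterate_H_mem_R hR _, h0⟩⟩
  calc _ ≤ _ := measure_mono hsub
    _ ≤ ∑ j ∈ Finset.range K, volume (H^[t j] ⁻¹' A) := measure_biUnion_finset_le _ _
    _ ≤ ∑ _j ∈ Finset.range K, ENNReal.ofReal (16 / h) := by
      refine Finset.sum_le_sum fun j _ => ?_
      rw [(measurePreserving_H.iterate (t j)).measure_preimage
        (measurableSet_toMeasurable _ _).nullMeasurableSet, measure_toMeasurable]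
      exact volume_absence_le hh
    _ = ENNReal.ofReal (K * (16 / h)) := by
      rw [Finset.sum_const, Finset.card_range, nsmul_eq_mul,
        ENNReal.ofReal_mul (Nat.cast_nonneg K), ENNReal.ofReal_natCast]

lemma block_length_le {K q n : ℕ} (hK : 0 < K) (hq : 42 * K ≤ q) (hn : 64 ^ q ≤ n) :
    (q + 1) * (14 * 7 ^ q) ≤ n / (3 * K) := by
  rw [Nat.le_div_iff_mul_le (by omega)]
  have h2 : q + 1 ≤ 2 ^ q := Nat.lt_two_pow_self
  have h4 : 42 * K ≤ 4 ^ q := hq.trans (Nat.lt_pow_self (by norm_num)).le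
  calc (q + 1) * (14 * 7 ^ q) * (3 * K) = (q + 1) * 7 ^ q * (42 * K) := by ring
    _ ≤ 2 ^ q * 7 ^ q * 4 ^ q := by gcongr
    _ = 56 ^ q := by rw [← mul_pow, ← mul_pow]; norm_num
    _ ≤ 64 ^ q := Nat.pow_le_pow_left (by norm_num) q
    _ ≤ n := hn

lemma volume_torus : (volume : Measure 𝕋) Set.univ = ENNReal.ofReal 4 := by
  rw [Measure.volume_eq_prod, ← Set.univ_prod_univ, Measure.prod_prod, AddCircle.measure_univ,
    ← ENNReal.ofReal_mul (by norm_num)]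
  norm_num

/-- The set of points of `R` making few returns to `S` has measure of order `1/n`. -/
theorem measure_of_few_returns :
    ∀ b : ℝ, 0 < b → ∃ C : ℝ, 0 < C ∧ ∀ n : ℕ, 2 ≤ n →
      (volume : Measure 𝕋) {z | z ∈ R ∧ (r z n : ℝ) ≤ b * Real.log n} ≤
        ENNReal.ofReal (C / n) := by
  intro b hb
  obtain ⟨K, hKb⟩ := exists_nat_gt (b * Real.log 64)
  have hlog : 0 < Real.log 64 := Real.log_pos (by norm_num)
  have hK : 0 < K := by
    have : (0:ℝ) < K := (mul_pos hb hlog).trans hKb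
    exact_mod_cast this
  have hKr : (0:ℝ) < K := by exact_mod_cast hK
  refine ⟨4 * 64 ^ (42 * K) + 96 * K ^ 2, by positivity, fun n hn => ?_⟩
  have hnr : (0:ℝ) < n := by exact_mod_cast (show 0 < n by omega)
  rcases lt_or_ge n (64 ^ (42 * K)) with hsmall | hlarge
  · refine (measure_mono (Set.subset_univ _)).trans ?_
    rw [volume_torus]
    apply ENNReal.ofReal_le_ofReal
    have : (n:ℝ) ≤ 64 ^ (42 * K) := by exact_mod_cast hsmall.le
    rw [le_div_iff₀ hnr]
    nlinarith [sq_nonneg (K:ℝ)]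
  · set q := Nat.log 64 n with hq
    have hqn : 64 ^ q ≤ n := Nat.pow_log_le_self 64 (by omega)
    have hqK : 42 * K ≤ q := (Nat.le_log_iff_pow_le (by norm_num) (by omega)).mpr hlarge
    set h := n / (3 * K) with hh
    have hblock : (q + 1) * (14 * 7 ^ q) ≤ h := block_length_le hK hqK hqn
    have h22 : 22 ≤ h := by
      have hpos : 1 ≤ 7 ^ q := Nat.one_le_pow _ _ (by norm_num)
      have : 2 * 14 ≤ (q + 1) * (14 * 7 ^ q) := Nat.mul_le_mul (by omega) (by omega)
      omega
    have hKh : K * (3 * h) ≤ n := by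
      have := Nat.mul_div_le n (3 * K)
      calc K * (3 * h) = 3 * K * (n / (3 * K)) := by rw [hh]; ring
        _ ≤ n := this
    have hlogn : Real.log n ≤ (q + 1) * Real.log 64 := by
      have hlt : n < 64 ^ (q + 1) := Nat.lt_pow_succ_log_self (by norm_num) n
      have : (n:ℝ) ≤ 64 ^ (q + 1) := by exact_mod_cast hlt.le
      calc Real.log n ≤ Real.log (64 ^ (q + 1)) := Real.log_le_log hnr this
        _ = (q + 1) * Real.log 64 := by rw [Real.log_pow]; push_cast; ring
    have hsub : {z : 𝕋 | z ∈ R ∧ (r z n : ℝ) ≤ b * Real.log n} ⊆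
        {z | z ∈ R ∧ ∃ j < K, r (H^[h + j * (3 * h)] z) h = 0} := by
      rintro z ⟨hR, hr⟩
      refine ⟨hR, exists_absence hR hblock hKh ?_⟩
      have : (r z n : ℝ) < K * (q + 1) :=
        calc (r z n : ℝ) ≤ b * Real.log n := hr
          _ ≤ b * ((q + 1) * Real.log 64) := mul_le_mul_of_nonneg_left hlogn hb.le
          _ = b * Real.log 64 * (q + 1) := by ring
          _ < K * (q + 1) := mul_lt_mul_of_pos_right hKb (by positivity)
      exact_mod_cast this
    refine (measure_mono hsub).trans ((volume_exists_absence_le h22 K _).trans ?_)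
    apply ENNReal.ofReal_le_ofReal
    have hhr : (0:ℝ) < h := by exact_mod_cast (show 0 < h by omega)
    have hnh : (n:ℝ) ≤ 6 * K * h := by
      have h1 : n < 3 * K * (h + 1) := Nat.lt_mul_div_succ n (by omega)
      have h2 : 3 * K * (h + 1) ≤ 3 * K * (2 * h) := Nat.mul_le_mul_left _ (by omega)
      have : n ≤ 6 * K * h := by
        calc n ≤ 3 * K * (2 * h) := h1.le.trans h2
          _ = 6 * K * h := by ring
      exact_mod_cast this
    have hC : (0:ℝ) ≤ 4 * 64 ^ (42 * K) := by positivity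
    rw [← mul_div_assoc, div_le_div_iff₀ hhr hnr]
    calc (K:ℝ) * 16 * n ≤ K * 16 * (6 * K * h) := by gcongr
      _ = 96 * K ^ 2 * h := by ring
      _ ≤ (4 * 64 ^ (42 * K) + 96 * K ^ 2) * h := by
        apply mul_le_mul_of_nonneg_right _ hhr.le
        linarith
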